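/- arXiv:2102.05352 — 3 statements merged into one kernel-verified Lean document; each statement's English description precedes it below -/
import Mathlib

section
/- Let a ≥ 3 be an integer and A = {1, 2, a}. Then the Diophantine equation y² = P_A(x) has infinitely many solutions in positive integers, i.e., the set {(x, y) ∈ ℕ₊ × ℕ₊ : y² = P_A(x)} is infinite. -/
/-- `partCount A n` is the number of partitions of `n` into parts from `A`. -/
def partCount (A : Finset ℕ) (n : ℕ) : ℕ :=
  ((Finset.univ : Finset (Nat.Partition n)).filter (fun p => ∀ i ∈ p.parts, i ∈ A)).card

/-- A multiset with all members in `{1, 2, a}` is determined by its multiplicities. -/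
theorem eq_replicate_of_forall_mem {a : ℕ} (ha : 3 ≤ a) {s : Multiset ℕ}
    (hs : ∀ i ∈ s, i ∈ ({1, 2, a} : Finset ℕ)) :
    s = Multiset.replicate (s.count 1) 1 + Multiset.replicate (s.count 2) 2 +
      Multiset.replicate (s.count a) a := by
  ext i
  simp only [Multiset.count_add, Multiset.count_replicate]
  by_cases hi : i ∈ s
  · have := hs i hi
    simp only [Finset.mem_insert, Finset.mem_singleton] at this
    rcases this with rfl | rfl | rfl
    · simp [show a ≠ 1 by omega]
    · simp [show a ≠ 2 by omega]
    · simp [show 1 ≠ i by omega, show 2 ≠ i by omega]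
  · rw [Multiset.count_eq_zero_of_notMem hi]
    split_ifs <;> subst_vars <;> simp_all

theorem sum_eq_of_forall_mem {a : ℕ} (ha : 3 ≤ a) {s : Multiset ℕ}
    (hs : ∀ i ∈ s, i ∈ ({1, 2, a} : Finset ℕ)) :
    s.sum = s.count 1 + 2 * s.count 2 + a * s.count a := by
  conv_lhs => rw [eq_replicate_of_forall_mem ha hs]
  simp only [Multiset.sum_add, Multiset.sum_replicate, smul_eq_mul]
  ring

theorem partCount_eq_sum {a : ℕ} (ha : 3 ≤ a) (n : ℕ) :
    partCount {1, 2, a} n = ∑ u ∈ Finset.range (n / a + 1), ((n - a * u) / 2 + 1) := by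
  have hcard : ∑ u ∈ Finset.range (n / a + 1), ((n - a * u) / 2 + 1) =
      ((Finset.range (n / a + 1)).sigma
        fun u => Finset.range ((n - a * u) / 2 + 1)).card := by
    simp
  rw [hcard, partCount]
  refine Finset.card_bij (fun p _ => ⟨p.parts.count a, p.parts.count 2⟩) ?_ ?_ ?_
  · intro p hp
    have h := sum_eq_of_forall_mem ha (Finset.mem_filter.1 hp).2
    rw [p.parts_sum] at h
    simp only [Finset.mem_sigma, Finset.mem_range, Nat.lt_succ_iff]
    refine ⟨(Nat.le_div_iff_mul_le (by omega)).2 ?_, ?_⟩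
    · rw [mul_comm]; omega
    · omega
  · intro p hp q hq h
    have hp' := (Finset.mem_filter.1 hp).2
    have hq' := (Finset.mem_filter.1 hq).2
    have h1 := sum_eq_of_forall_mem ha hp'
    have h2 := sum_eq_of_forall_mem ha hq'
    rw [p.parts_sum] at h1
    rw [q.parts_sum] at h2
    simp only [Sigma.mk.injEq, heq_eq_eq] at h
    rw [h.1, h.2] at h1
    ext1
    rw [eq_replicate_of_forall_mem ha hp', eq_replicate_of_forall_mem ha hq', h.1, h.2,
      show p.parts.count 1 = q.parts.count 1 by omega]
  · rintro ⟨u, v⟩ huv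
    simp only [Finset.mem_sigma, Finset.mem_range, Nat.lt_succ_iff] at huv
    obtain ⟨hu, hv⟩ := huv
    rw [Nat.le_div_iff_mul_le (by omega), mul_comm] at hu
    have hmem : ∀ i ∈ Multiset.replicate (n - a * u - 2 * v) 1 + Multiset.replicate v 2 +
        Multiset.replicate u a, i = 1 ∨ i = 2 ∨ i = a := by
      intro i hi
      simp only [Multiset.mem_add, Multiset.mem_replicate] at hi
      tauto
    refine ⟨⟨Multiset.replicate (n - a * u - 2 * v) 1 + Multiset.replicate v 2 +
      Multiset.replicate u a, fun {i} hi => ?_, ?_⟩, ?_, ?_⟩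
    · rcases hmem i hi with h | h | h <;> omega
    · simp only [Multiset.sum_add, Multiset.sum_replicate, smul_eq_mul]
      rw [mul_comm u a]
      omega
    · simpa using hmem
    · simp [Multiset.count_replicate, show 1 ≠ a by omega, show 2 ≠ a by omega,
        show a ≠ 2 by omega]

theorem partCount_mul_add {a : ℕ} (ha : 3 ≤ a) (k : ℕ) {r : ℕ} (hr : r < a) :
    partCount {1, 2, a} (a * k + r) = ∑ i ∈ Finset.range (k + 1), ((a * i + r) / 2 + 1) := by
  rw [partCount_eq_sum ha, Nat.mul_add_div (by omega), Nat.div_eq_of_lt hr, add_zero,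
    ← Finset.sum_range_reflect]
  refine Finset.sum_congr rfl fun i hi => ?_
  rw [Finset.mem_range] at hi
  obtain ⟨j, rfl⟩ := Nat.exists_eq_add_of_le (Nat.lt_succ_iff.1 hi)
  rw [show i + j + 1 - 1 - i = j by omega, mul_add,
    show a * i + a * j + r - a * j = a * i + r by omega]

theorem two_mul_sum_even (b s k : ℕ) :
    2 * ∑ i ∈ Finset.range k, ((2 * b * i + 2 * s) / 2 + 1) + b * k =
      k * (b * k + 2 * (s + 1)) := by
  induction k with
  | zero => simp
  | succ k ih =>
    rw [Finset.sum_range_succ, mul_assoc 2 b k, ← mul_add, Nat.mul_div_cancel_left _ two_pos]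
    linarith

theorem sum_odd_square (d m : ℕ) :
    ∑ i ∈ Finset.range (2 * m), (((2 * d + 3) * i + d) / 2 + 1) = (2 * d + 3) * m ^ 2 := by
  induction m with
  | zero => simp
  | succ m ih =>
    rw [mul_add, mul_one, Finset.sum_range_succ, Finset.sum_range_succ, ih,
      show (2 * d + 3) * (2 * m) + d = 2 * ((2 * d + 3) * m) + d by ring,
      show (2 * d + 3) * (2 * m + 1) + d = 2 * ((2 * d + 3) * m) + (3 * d + 3) by ring,
      show (2 * d + 3) * (m + 1) ^ 2 =
        (2 * d + 3) * m ^ 2 + 2 * ((2 * d + 3) * m) + (2 * d + 3) by ring]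
    omega

theorem sum_odd_pell (c m : ℕ) :
    ∑ i ∈ Finset.range (2 * m), (((2 * c + 1) * i + c) / 2 + 1) =
      m * ((2 * c + 1) * m + 1) := by
  induction m with
  | zero => simp
  | succ m ih =>
    rw [mul_add, mul_one, Finset.sum_range_succ, Finset.sum_range_succ, ih,
      show (2 * c + 1) * (2 * m) + c = 2 * ((2 * c + 1) * m) + c by ring,
      show (2 * c + 1) * (2 * m + 1) + c = 2 * ((2 * c + 1) * m) + (3 * c + 1) by ring,
      show (m + 1) * ((2 * c + 1) * (m + 1) + 1) =
        m * ((2 * c + 1) * m + 1) + 2 * ((2 * c + 1) * m) + (2 * c + 2) by ring]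
    omega

theorem exists_pell_solution_gt {d : ℕ} (hd : ¬ IsSquare d) (N : ℕ) :
    ∃ x y : ℕ, N < y ∧ x ^ 2 = d * y ^ 2 + 1 := by
  induction N with
  | zero =>
    have hd0 : 0 < d := Nat.pos_of_ne_zero fun h => hd (h ▸ IsSquare.zero)
    obtain ⟨x, y, h, hy⟩ := Pell.exists_of_not_isSquare (d := (d : ℤ)) (by exact_mod_cast hd0)
      (by rwa [Int.isSquare_natCast_iff])
    refine ⟨x.natAbs, y.natAbs, Int.natAbs_pos.2 hy, ?_⟩
    zify
    rw [sq_abs, sq_abs]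
    linarith
  | succ N ih =>
    obtain ⟨x, y, hy, h⟩ := ih
    have hx : 0 < x := Nat.pos_of_ne_zero fun h0 => by simp [h0] at h
    refine ⟨x ^ 2 + d * y ^ 2, 2 * x * y, ?_, ?_⟩
    · nlinarith
    · rw [h]
      linear_combination (4 * d * y ^ 2 : ℕ) * h.symm

theorem infinite_of_forall_exists {f : ℕ → ℕ}
    (h : ∀ N, ∃ x y, N < x ∧ 0 < y ∧ y ^ 2 = f x) :
    {xy : ℕ × ℕ | 0 < xy.1 ∧ 0 < xy.2 ∧ xy.2 ^ 2 = f xy.1}.Infinite := by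
  refine Set.Infinite.of_image Prod.fst (Set.infinite_of_forall_exists_gt fun N => ?_)
  obtain ⟨x, y, hx, hy, hxy⟩ := h N
  exact ⟨x, ⟨(x, y), ⟨by dsimp only; omega, hy, hxy⟩, rfl⟩, hx⟩

theorem stmt16 (a : ℕ) (ha : 3 ≤ a) :
    {xy : ℕ × ℕ | 0 < xy.1 ∧ 0 < xy.2 ∧
      xy.2 ^ 2 = partCount {1, 2, a} xy.1}.Infinite := by
  -- It suffices to find, for a suitable residue `r`, arbitrarily large `k` that work.
  suffices h : ∃ r < a, ∀ N, ∃ k y, N < k + 1 ∧ 0 < y ∧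
      y ^ 2 = ∑ i ∈ Finset.range (k + 1), ((a * i + r) / 2 + 1) by
    obtain ⟨r, hr, h⟩ := h
    refine infinite_of_forall_exists fun N => ?_
    obtain ⟨k, y, hk, hy, hky⟩ := h (N + 1)
    exact ⟨a * k + r, y, by nlinarith, hy, by rw [hky, partCount_mul_add ha k hr]⟩
  suffices h : ∃ r < a, ∀ N, ∃ k y, N < k ∧ 0 < y ∧
      y ^ 2 = ∑ i ∈ Finset.range k, ((a * i + r) / 2 + 1) by
    obtain ⟨r, hr, h⟩ := h
    refine ⟨r, hr, fun N => ?_⟩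
    obtain ⟨k, y, hk, h'⟩ := h N
    obtain ⟨k, rfl⟩ := Nat.exists_eq_succ_of_ne_zero (Nat.ne_zero_of_lt hk)
    exact ⟨k, y, hk, h'⟩
  rcases Nat.even_or_odd' a with ⟨b, rfl | rfl⟩
  · by_cases hsq : IsSquare (2 * b)
    · obtain ⟨w, hw⟩ := hsq
      obtain ⟨c, rfl⟩ : 2 ∣ w := by
        have : 2 ∣ w * w := ⟨b, hw.symm⟩
        simpa [Nat.prime_two.dvd_mul] using this
      have hb : b = 2 * (c * c) := by linarith
      have hc : 0 < c * c := by omega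
      obtain ⟨s, hs⟩ := Nat.exists_eq_succ_of_ne_zero hc.ne'
      refine ⟨2 * s, by omega, fun N => ⟨N + 1, c * (N + 1), by omega, ?_, ?_⟩⟩
      · have := Nat.pos_of_mul_pos_left hc
        positivity
      · have := two_mul_sum_even b s (N + 1)
        rw [← Nat.succ_eq_add_one s, ← hs,
          show b * (N + 1) = 2 * (c * c) * (N + 1) by rw [hb]] at this
        linarith
    · obtain ⟨s, rfl⟩ := Nat.exists_eq_succ_of_ne_zero (show b ≠ 0 by omega)
      refine ⟨2 * s, by omega, fun N => ?_⟩
      obtain ⟨x, y, hy, hxy⟩ := exists_pell_solution_gt hsq N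
      have hx : 0 < x := Nat.pos_of_ne_zero fun h0 => by simp [h0] at hxy
      have hy0 : 0 < y := by omega
      refine ⟨2 * (s + 1) * y ^ 2, (s + 1) * x * y, by nlinarith, by positivity, ?_⟩
      have := two_mul_sum_even (s + 1) s (2 * (s + 1) * y ^ 2)
      simp only [Nat.succ_eq_add_one] at *
      rw [mul_pow, mul_pow, hxy]
      linarith
  · by_cases hsq : IsSquare (2 * b + 1)
    · obtain ⟨w, hw⟩ := hsq
      obtain ⟨d, rfl⟩ := Nat.exists_eq_succ_of_ne_zero (show b ≠ 0 by omega)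
      refine ⟨d, by omega, fun N => ⟨2 * (N + 1), w * (N + 1), by omega, ?_, ?_⟩⟩
      · have : 0 < w := Nat.pos_of_ne_zero fun h0 => by simp [h0] at hw
        positivity
      · rw [show 2 * d.succ + 1 = 2 * d + 3 by omega, sum_odd_square,
          show 2 * d + 3 = w * w by omega]
        ring
    · refine ⟨b, by omega, fun N => ?_⟩
      obtain ⟨x, y, hy, hxy⟩ := exists_pell_solution_gt hsq N
      have hx : 0 < x := Nat.pos_of_ne_zero fun h0 => by simp [h0] at hxy
      have hy0 : 0 < y := by omega
      refine ⟨2 * y ^ 2, x * y, by nlinarith, by positivity, ?_⟩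
      rw [sum_odd_pell, mul_pow, hxy, mul_comm]
end

section
/- Let a and b be integers with 3 ≤ a < b, both a and b divisible by 4, and such that at least one of a/2 and b/2 is not a perfect square. Put A = {1, 2, a} and B = {1, 2, b}. Then the Diophantine equation P_A(x) = P_B(y) has infinitely many solutions in positive integers, i.e., the set {(x, y) ∈ ℕ₊ × ℕ₊ : P_A(x) = P_B(y)} is infinite. -/
/-- A partition of `4 * e * q + 2 * r` into parts from `{1, 2, 4 * e}` is determined by the
multiplicities of `4 * e` and of `2`. -/
theorem partCount_eq_card_sigma (e q r : ℕ) (he : 0 < e) (hr : r < 2 * e) :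
    partCount {1, 2, 4 * e} (4 * e * q + 2 * r) =
      ((Finset.range (q + 1)).sigma
        fun k => Finset.range (2 * e * (q - k) + r + 1)).card := by
  have parts_sum : ∀ p : Nat.Partition (4 * e * q + 2 * r),
      (∀ i ∈ p.parts, i ∈ ({1, 2, 4 * e} : Finset ℕ)) →
      p.parts.count 1 + p.parts.count 2 * 2 + p.parts.count (4 * e) * (4 * e) =
        4 * e * q + 2 * r := by
    intro p hp
    have h := Finset.sum_multiset_count_of_subset p.parts {1, 2, 4 * e}
      (fun i hi => hp i (Multiset.mem_toFinset.1 hi))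
    rw [p.parts_sum, Finset.sum_insert (by simp; omega), Finset.sum_insert (by simp; omega),
      Finset.sum_singleton] at h
    simp only [smul_eq_mul] at h
    omega
  unfold partCount
  refine Finset.card_bij
    (fun p _ => (⟨p.parts.count (4 * e), p.parts.count 2⟩ : Σ _ : ℕ, ℕ)) ?_ ?_ ?_
  · intro p hp
    have h := parts_sum p (Finset.mem_filter.1 hp).2
    generalize p.parts.count 1 = i at h
    simp only [Finset.mem_sigma, Finset.mem_range]
    generalize p.parts.count 2 = j at h ⊢
    generalize p.parts.count (4 * e) = k at h ⊢
    have hk : k ≤ q := by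
      by_contra! hk
      have : 4 * e * (q + 1) ≤ 4 * e * k := Nat.mul_le_mul_left _ hk
      nlinarith
    obtain ⟨m, rfl⟩ := Nat.exists_eq_add_of_le hk
    refine ⟨by omega, ?_⟩
    rw [Nat.add_sub_cancel_left]
    nlinarith
  · intro p hp p' hp' heq
    rw [Finset.mem_filter] at hp hp'
    have h := parts_sum p hp.2
    have h' := parts_sum p' hp'.2
    simp only [Sigma.mk.injEq, heq_eq_eq] at heq
    obtain ⟨hk, hj⟩ := heq
    rw [hk, hj] at h
    ext i
    by_cases hi : i ∈ ({1, 2, 4 * e} : Finset ℕ)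
    · simp only [Finset.mem_insert, Finset.mem_singleton] at hi
      rcases hi with rfl | rfl | rfl
      · omega
      · exact hj
      · exact hk
    · rw [Multiset.count_eq_zero_of_notMem fun hm => hi (hp.2 i hm),
        Multiset.count_eq_zero_of_notMem fun hm => hi (hp'.2 i hm)]
  · rintro ⟨k, j⟩ hkj
    simp only [Finset.mem_sigma, Finset.mem_range] at hkj
    obtain ⟨hk, hj⟩ := hkj
    obtain ⟨m, rfl⟩ := Nat.exists_eq_add_of_le (Nat.lt_succ_iff.1 hk)
    rw [Nat.add_sub_cancel_left] at hj
    obtain ⟨l, hl⟩ := Nat.exists_eq_add_of_le (Nat.lt_succ_iff.1 hj)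
    have hmem : ∀ i ∈ Multiset.replicate k (4 * e) + Multiset.replicate j 2 +
        Multiset.replicate (2 * l) 1, i ∈ ({1, 2, 4 * e} : Finset ℕ) := by
      intro i hi
      simp only [Multiset.mem_add, Multiset.mem_replicate] at hi
      simp only [Finset.mem_insert, Finset.mem_singleton]
      tauto
    refine ⟨⟨Multiset.replicate k (4 * e) + Multiset.replicate j 2 +
        Multiset.replicate (2 * l) 1, ?_, ?_⟩, ?_, ?_⟩
    · intro i hi
      have := hmem i hi
      simp only [Finset.mem_insert, Finset.mem_singleton] at this
      omega
    · simp only [Multiset.sum_add, Multiset.sum_replicate, smul_eq_mul]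
      linarith
    · simpa using hmem
    · have h2 : 4 * e ≠ 2 := by omega
      have h1 : 4 * e ≠ 1 := by omega
      simp [Multiset.count_replicate, h2, h2.symm, h1.symm]

theorem partCount_four_mul (e q r : ℕ) (he : 0 < e) (hr : r < 2 * e) :
    partCount {1, 2, 4 * e} (4 * e * q + 2 * r) = (q + 1) * (e * q + r + 1) := by
  rw [partCount_eq_card_sigma e q r he hr, Finset.card_sigma]
  simp only [Finset.card_range]
  have h := Finset.sum_range_reflect (fun j => 2 * e * j + r + 1) (q + 1)
  simp only [Nat.add_sub_cancel] at h
  rw [h]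
  clear h
  induction q with
  | zero => simp
  | succ q ih => rw [Finset.sum_range_succ, ih]; ring

theorem partCount_eq_quadratic (e Q t : ℕ) (he : 0 < e) (ht : t ≤ 1) :
    partCount {1, 2, 4 * e} (4 * e * Q + 2 * (e - 1 + t)) = (Q + 1) * (e * (Q + 1) + t) := by
  rw [partCount_four_mul e Q _ he (by omega)]
  congr 1
  obtain ⟨c, rfl⟩ := Nat.exists_eq_add_of_lt he
  simp only [zero_add, Nat.add_sub_cancel]
  ring

/-- For non-square `d`, Pell's equation has solutions with arbitrarily large second component. -/
theorem exists_large_pell_solution (d N : ℕ) (hd : ¬ IsSquare d) :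
    ∃ p z : ℕ, N < z ∧ p ^ 2 = d * z ^ 2 + 1 := by
  have hd0 : 0 < d := Nat.pos_of_ne_zero fun h => hd (h ▸ ⟨0, rfl⟩)
  have hsq : ¬ IsSquare ((d * (N + 1) ^ 2 : ℕ) : ℤ) := by
    rw [Int.isSquare_natCast_iff]
    rintro ⟨s, hs⟩
    have hdvd : N + 1 ∣ s := by
      rw [← Nat.pow_dvd_pow_iff two_ne_zero, sq s, ← hs]
      exact dvd_mul_left _ _
    obtain ⟨w, rfl⟩ := hdvd
    refine hd ⟨w, Nat.eq_of_mul_eq_mul_right (show 0 < (N + 1) ^ 2 by positivity) ?_⟩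
    rw [hs]
    ring
  obtain ⟨x, y, hxy, hy⟩ := Pell.exists_of_not_isSquare (by positivity) hsq
  refine ⟨x.natAbs, (N + 1) * y.natAbs, ?_, ?_⟩
  · have := Int.natAbs_pos.2 hy
    nlinarith
  · zify
    rw [mul_pow, sq_abs, sq_abs]
    push_cast at hxy
    linarith

theorem exists_large_quadratic_eq (e f N : ℕ) (he : 0 < e) (hf : 0 < f) :
    ∃ Q R t : ℕ, N < Q ∧ 0 < R ∧ t ≤ 1 ∧ Q * (e * Q + t) = R * (f * R + t) := by
  by_cases h : IsSquare (e * f)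
  · obtain ⟨s, hs⟩ := h
    have hs0 : 0 < s := Nat.pos_of_ne_zero fun h0 => by
      have := Nat.mul_pos he hf
      simp [hs, h0] at this
    refine ⟨s * (N + 1), e * (N + 1), 0, by nlinarith, by positivity, by simp, ?_⟩
    calc s * (N + 1) * (e * (s * (N + 1)) + 0) = s * s * e * (N + 1) ^ 2 := by ring
      _ = e * (N + 1) * (f * (e * (N + 1)) + 0) := by rw [← hs]; ring
  · obtain ⟨p, z, hz, hp⟩ := exists_large_pell_solution (e * f) N h
    have hp0 : 0 < p := Nat.pos_of_ne_zero fun h0 => by simp [h0] at hp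
    have hz0 : 0 < z := by omega
    refine ⟨z * (f * z + p), z * (e * z + p), 1, by nlinarith, by positivity, le_rfl, ?_⟩
    have hQ : e * (z * (f * z + p)) + 1 = p * (e * z + p) := by linarith
    have hR : f * (z * (e * z + p)) + 1 = p * (f * z + p) := by linarith
    rw [hQ, hR]
    ring

theorem stmt17 (a b : ℕ) (ha : 3 ≤ a) (hab : a < b) (ha4 : 4 ∣ a) (hb4 : 4 ∣ b)
    (hsq : ¬ IsSquare (a / 2) ∨ ¬ IsSquare (b / 2)) :
    {xy : ℕ × ℕ | 0 < xy.1 ∧ 0 < xy.2 ∧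
      partCount {1, 2, a} xy.1 = partCount {1, 2, b} xy.2}.Infinite := by
  obtain ⟨e, rfl⟩ := ha4
  obtain ⟨f, rfl⟩ := hb4
  have he : 0 < e := by omega
  refine Set.Infinite.of_image Prod.fst (Set.infinite_of_forall_exists_gt fun N => ?_)
  obtain ⟨Q, R, t, hQ, hR, ht, h⟩ := exists_large_quadratic_eq e f (N + 1) he (by omega)
  obtain ⟨Q, rfl⟩ := Nat.exists_eq_add_of_lt (Nat.zero_lt_of_lt hQ)
  obtain ⟨R, rfl⟩ := Nat.exists_eq_add_of_lt hR
  simp only [zero_add] at h hQ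
  have hlarge : N < 4 * e * Q + 2 * (e - 1 + t) := by nlinarith
  refine ⟨_, ⟨(4 * e * Q + 2 * (e - 1 + t), 4 * f * R + 2 * (f - 1 + t)),
    ⟨by simp only; omega, by simp only; omega, ?_⟩, rfl⟩, hlarge⟩
  simp only
  rw [partCount_eq_quadratic e Q t he ht, partCount_eq_quadratic f R t (by omega) ht, h]
end

section
/- Let a ≥ 3 be an integer with a ≡ 1, 2, 5, 7, 10, or 11 (mod 12), and set b = 4a, A = {1, 2, a}, B = {1, 2, 3, 4, b}. Then the Diophantine equation P_A(x) = P_B(y) has infinitely many solutions in positive integers, i.e., the set {(x, y) ∈ ℕ₊ × ℕ₊ : P_A(x) = P_B(y)} is infinite. -/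
open Finset in
theorem partCount_insert_of_lt {A : Finset ℕ} {a n : ℕ} (h : n < a) :
    partCount (insert a A) n = partCount A n := by
  unfold partCount
  congr 1
  refine filter_congr fun p _ => forall₂_congr fun i hi => ?_
  have : i ≤ n := p.parts_sum ▸ Multiset.le_sum_of_mem hi
  simp only [mem_insert, or_iff_right_iff_imp]
  omega

open Finset in
theorem partCount_insert_add {A : Finset ℕ} {a : ℕ} (ha : 0 < a) (haA : a ∉ A) (n : ℕ) :
    partCount (insert a A) (n + a) = partCount A (n + a) + partCount (insert a A) n := by
  unfold partCount
  rw [← card_filter_add_card_filter_not (fun p : Nat.Partition (n + a) => a ∉ p.parts)]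
  congr 1
  · congr 1
    ext p
    simp only [mem_filter, mem_univ, true_and, mem_insert]
    constructor
    · rintro ⟨h, hp⟩ i hi
      exact (h i hi).resolve_left fun e => hp (e ▸ hi)
    · exact fun h => ⟨fun i hi => Or.inr (h i hi), fun hp => haA (h a hp)⟩
  · symm
    refine card_bij (fun p _ => ⟨a ::ₘ p.parts, ?_, ?_⟩) ?_ ?_ ?_
    · intro i hi
      rcases Multiset.mem_cons.1 hi with rfl | hi
      exacts [ha, p.parts_pos hi]
    · rw [Multiset.sum_cons, p.parts_sum, add_comm]
    · intro p hp
      simp only [mem_filter, mem_univ, true_and, mem_insert, Multiset.mem_cons] at hp ⊢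
      exact ⟨fun i hi => hi.elim Or.inl (hp i), by simp⟩
    · intro p _ q _ h
      have h' := congrArg Nat.Partition.parts h
      exact Nat.Partition.ext ((Multiset.cons_inj_right a).1 h')
    · intro q hq
      simp only [mem_filter, mem_univ, true_and, mem_insert, not_not] at hq
      refine ⟨⟨q.parts.erase a, fun hi => q.parts_pos (Multiset.mem_of_mem_erase hi), ?_⟩, ?_, ?_⟩
      · have h := q.parts_sum
        rw [← Multiset.cons_erase hq.2, Multiset.sum_cons] at h
        omega
      · simp only [mem_filter, mem_univ, true_and, mem_insert]
        exact fun i hi => hq.1 i (Multiset.mem_of_mem_erase hi)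
      · exact Nat.Partition.ext (Multiset.cons_erase hq.2)

theorem partCount_empty_zero : partCount ∅ 0 = 1 := by decide

theorem partCount_empty_succ (n : ℕ) : partCount ∅ (n + 1) = 0 := by
  unfold partCount
  rw [Finset.card_eq_zero, Finset.filter_eq_empty_iff]
  intro p _ h
  have hs := p.parts_sum
  rw [Multiset.eq_zero_of_forall_notMem fun i hi => Finset.notMem_empty i (h i hi)] at hs
  simp at hs

theorem partCount_one (n : ℕ) : partCount {1} n = 1 := by
  rw [← insert_empty_eq]
  induction n with
  | zero => rw [partCount_insert_of_lt one_pos, partCount_empty_zero]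
  | succ n ih => rw [partCount_insert_add one_pos (by simp), ih, partCount_empty_succ]

theorem partCount_one_two (n : ℕ) : partCount {1, 2} n = n / 2 + 1 := by
  rw [Finset.pair_comm]
  induction n using Nat.twoStepInduction with
  | zero => rw [partCount_insert_of_lt two_pos, partCount_one]
  | one => rw [partCount_insert_of_lt one_lt_two, partCount_one]
  | more n ih _ =>
    rw [partCount_insert_add two_pos (by simp), ih, partCount_one]
    omega

theorem partCount_one_two_three_add (n : ℕ) :
    partCount {1, 2, 3} (n + 3) = (n + 3) / 2 + 1 + partCount {1, 2, 3} n := by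
  rw [show ({1, 2, 3} : Finset ℕ) = insert 3 {1, 2} by decide,
    partCount_insert_add (by norm_num) (by simp), partCount_one_two]

theorem partCount_one_two_three_of_lt {n : ℕ} (h : n < 3) :
    partCount {1, 2, 3} n = n / 2 + 1 := by
  rw [show ({1, 2, 3} : Finset ℕ) = insert 3 {1, 2} by decide,
    partCount_insert_of_lt h, partCount_one_two]

theorem partCount_one_two_three (s : ℕ) :
    partCount {1, 2, 3} (6 * s + 1) = 3 * s ^ 2 + 4 * s + 1 ∧
    partCount {1, 2, 3} (6 * s + 3) = 3 * s ^ 2 + 6 * s + 3 ∧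
    partCount {1, 2, 3} (6 * s + 5) = 3 * s ^ 2 + 8 * s + 5 := by
  have step (n : ℕ) : partCount {1, 2, 3} (n + 6) = n + 6 + partCount {1, 2, 3} n := by
    rw [partCount_one_two_three_add (n + 3), partCount_one_two_three_add n]
    omega
  induction s with
  | zero =>
    have h0 := partCount_one_two_three_add 0
    have h2 := partCount_one_two_three_add 2
    rw [partCount_one_two_three_of_lt (n := 0) (by norm_num)] at h0
    rw [partCount_one_two_three_of_lt (n := 2) (by norm_num)] at h2
    exact ⟨partCount_one_two_three_of_lt (by norm_num), h0, h2⟩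
  | succ s ih =>
    obtain ⟨h1, h3, h5⟩ := ih
    refine ⟨?_, ?_, ?_⟩
    · rw [show 6 * (s + 1) + 1 = 6 * s + 1 + 6 by ring, step, h1]; ring
    · rw [show 6 * (s + 1) + 3 = 6 * s + 3 + 6 by ring, step, h3]; ring
    · rw [show 6 * (s + 1) + 5 = 6 * s + 5 + 6 by ring, step, h5]; ring

theorem partCount_one_two_three_four (s : ℕ) :
    partCount {1, 2, 3, 4} (12 * s + 1) = 12 * s ^ 3 + 18 * s ^ 2 + 8 * s + 1 ∧
    partCount {1, 2, 3, 4} (12 * s + 5) = 12 * s ^ 3 + 30 * s ^ 2 + 24 * s + 6 ∧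
    partCount {1, 2, 3, 4} (12 * s + 9) = 12 * s ^ 3 + 42 * s ^ 2 + 48 * s + 18 := by
  have hset : ({1, 2, 3, 4} : Finset ℕ) = insert 4 {1, 2, 3} := by decide
  have step (n : ℕ) : partCount {1, 2, 3, 4} (n + 4) =
      partCount {1, 2, 3} (n + 4) + partCount {1, 2, 3, 4} n := by
    rw [hset, partCount_insert_add (by norm_num) (by simp)]
  have h5 (s : ℕ) : partCount {1, 2, 3, 4} (12 * s + 5) =
      12 * s ^ 2 + 16 * s + 5 + partCount {1, 2, 3, 4} (12 * s + 1) := by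
    rw [step (12 * s + 1), show 12 * s + 1 + 4 = 6 * (2 * s) + 5 by ring,
      (partCount_one_two_three _).2.2]
    ring
  have h9 (s : ℕ) : partCount {1, 2, 3, 4} (12 * s + 9) =
      12 * s ^ 2 + 24 * s + 12 + partCount {1, 2, 3, 4} (12 * s + 5) := by
    rw [step (12 * s + 5), show 12 * s + 5 + 4 = 6 * (2 * s + 1) + 3 by ring,
      (partCount_one_two_three _).2.1]
    ring
  have h1 : partCount {1, 2, 3, 4} (12 * s + 1) = 12 * s ^ 3 + 18 * s ^ 2 + 8 * s + 1 := by
    induction s with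
    | zero =>
      rw [hset, partCount_insert_of_lt (by norm_num), partCount_one_two_three_of_lt (by norm_num)]
      norm_num
    | succ s ih =>
      rw [show 12 * (s + 1) + 1 = 12 * s + 9 + 4 by ring, step, h9, h5, ih,
        show 12 * s + 9 + 4 = 6 * (2 * s + 2) + 1 by ring, (partCount_one_two_three _).1]
      ring
  refine ⟨h1, ?_, ?_⟩
  · rw [h5, h1]; ring
  · rw [h9, h5, h1]; ring

theorem insert_one_two (a : ℕ) : ({1, 2, a} : Finset ℕ) = insert a {1, 2} := by
  ext; simp only [Finset.mem_insert, Finset.mem_singleton]; tauto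

theorem partCount_one_two_insert_add {a : ℕ} (ha : 3 ≤ a) (n : ℕ) :
    partCount {1, 2, a} (n + a) = (n + a) / 2 + 1 + partCount {1, 2, a} n := by
  rw [insert_one_two, partCount_insert_add (by omega) (by simp; omega), partCount_one_two]

theorem partCount_one_two_insert_of_lt {a n : ℕ} (h : n < a) :
    partCount {1, 2, a} n = n / 2 + 1 := by
  rw [insert_one_two, partCount_insert_of_lt h, partCount_one_two]

theorem partCount_one_two_insert {a M c : ℕ} (ha : 3 ≤ a)
    (hM : (a ≤ M ∧ M < 2 * a ∧ M / 2 + 1 + ((M - a) / 2 + 1) = c) ∨ (M < a ∧ M / 2 + 1 = c))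
    (hc : (M + a) / 2 + (M + 2 * a) / 2 + 2 = 2 * a + c) (w : ℕ) :
    partCount {1, 2, a} (M + 2 * a * w) = a * w * (w + 1) + c * (w + 1) := by
  induction w with
  | zero =>
    rcases hM with ⟨h1, h2, h3⟩ | ⟨h1, h2⟩
    · obtain ⟨m, rfl⟩ := Nat.exists_eq_add_of_le' h1
      have := partCount_one_two_insert_add ha m
      rw [partCount_one_two_insert_of_lt (n := m) (by omega)] at this
      simp only [mul_zero, add_zero, zero_mul, this]
      omega
    · simp only [mul_zero, add_zero, zero_mul, partCount_one_two_insert_of_lt h1]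
      omega
  | succ w ih =>
    rw [show M + 2 * a * (w + 1) = M + 2 * a * w + a + a by ring,
      partCount_one_two_insert_add ha, partCount_one_two_insert_add ha, ih,
      show M + 2 * a * w + a + a = M + 2 * a + 2 * (a * w) by ring,
      show M + 2 * a * w + a = M + a + 2 * (a * w) by ring,
      Nat.add_mul_div_left (M + 2 * a) (a * w) two_pos,
      Nat.add_mul_div_left (M + a) (a * w) two_pos]
    linear_combination hc

theorem insert_one_two_three_four (b : ℕ) :
    ({1, 2, 3, 4, b} : Finset ℕ) = insert b {1, 2, 3, 4} := by
  ext; simp only [Finset.mem_insert, Finset.mem_singleton]; tauto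

theorem partCount_one_two_three_four_insert_add {b : ℕ} (hb : 5 ≤ b) (n : ℕ) :
    partCount {1, 2, 3, 4, b} (n + b) =
      partCount {1, 2, 3, 4} (n + b) + partCount {1, 2, 3, 4, b} n := by
  rw [insert_one_two_three_four, partCount_insert_add (by omega) (by simp; omega)]

theorem partCount_one_two_three_four_insert_of_lt {b n : ℕ} (h : n < b) :
    partCount {1, 2, 3, 4, b} n = partCount {1, 2, 3, 4} n := by
  rw [insert_one_two_three_four, partCount_insert_of_lt h]

/-- For `e ≥ 1`, the value at `12 a (t + 1) - 3`, where `a = 3 e + 1`. -/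
theorem partCount_at_neg_three {e : ℕ} (he : 1 ≤ e) (t : ℕ) :
    partCount {1, 2, 3, 4, 4 * (3 * e + 1)} (12 * (3 * e + 1) * t + 36 * e + 9) =
      (3 * e + 1) * (3 * (3 * e + 1) * (t + 1) ^ 2 + (3 * e + 2) * t + 3 * e + 1) *
        (3 * (3 * e + 1) * (t + 1) ^ 2 + (3 * e + 2) * t + 3 * e + 1 + 1) +
      (4 * e + 1) * (3 * (3 * e + 1) * (t + 1) ^ 2 + (3 * e + 2) * t + 3 * e + 1 + 1) := by
  have step := partCount_one_two_three_four_insert_add (b := 4 * (3 * e + 1)) (by omega)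
  induction t with
  | zero =>
    rw [show 12 * (3 * e + 1) * 0 + 36 * e + 9 =
        12 * e + 1 + 4 * (3 * e + 1) + 4 * (3 * e + 1) by ring, step, step,
      partCount_one_two_three_four_insert_of_lt (by omega),
      show 12 * e + 1 + 4 * (3 * e + 1) + 4 * (3 * e + 1) = 12 * (3 * e) + 9 by ring,
      show 12 * e + 1 + 4 * (3 * e + 1) = 12 * (2 * e) + 5 by ring,
      (partCount_one_two_three_four _).1, (partCount_one_two_three_four _).2.1,
      (partCount_one_two_three_four _).2.2]
    ring
  | succ t ih =>
    rw [show 12 * (3 * e + 1) * (t + 1) + 36 * e + 9 = 12 * (3 * e + 1) * t + 36 * e + 9 +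
        4 * (3 * e + 1) + 4 * (3 * e + 1) + 4 * (3 * e + 1) by ring, step, step, step, ih,
      show 12 * (3 * e + 1) * t + 36 * e + 9 + 4 * (3 * e + 1) + 4 * (3 * e + 1) +
        4 * (3 * e + 1) = 12 * (e * (3 * t + 6) + t + 1) + 9 by ring,
      show 12 * (3 * e + 1) * t + 36 * e + 9 + 4 * (3 * e + 1) + 4 * (3 * e + 1) =
        12 * (e * (3 * t + 5) + t + 1) + 5 by ring,
      show 12 * (3 * e + 1) * t + 36 * e + 9 + 4 * (3 * e + 1) =
        12 * (e * (3 * t + 4) + t + 1) + 1 by ring,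
      (partCount_one_two_three_four _).1, (partCount_one_two_three_four _).2.1,
      (partCount_one_two_three_four _).2.2]
    ring

/-- For `e ≥ 1`, the value at `12 a (t + 1) - 7`, where `a = 3 e + 2`. -/
theorem partCount_at_neg_seven {e : ℕ} (he : 1 ≤ e) (t : ℕ) :
    partCount {1, 2, 3, 4, 4 * (3 * e + 2)} (12 * (3 * e + 2) * t + 36 * e + 17) =
      (3 * e + 2) * (3 * (3 * e + 2) * (t + 1) ^ 2 + (3 * e + 1) * t + 3 * e) *
        (3 * (3 * e + 2) * (t + 1) ^ 2 + (3 * e + 1) * t + 3 * e + 1) +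
      (2 * e + 1) * (3 * (3 * e + 2) * (t + 1) ^ 2 + (3 * e + 1) * t + 3 * e + 1) := by
  have step := partCount_one_two_three_four_insert_add (b := 4 * (3 * e + 2)) (by omega)
  induction t with
  | zero =>
    rw [show 12 * (3 * e + 2) * 0 + 36 * e + 17 =
        12 * e + 1 + 4 * (3 * e + 2) + 4 * (3 * e + 2) by ring, step, step,
      partCount_one_two_three_four_insert_of_lt (by omega),
      show 12 * e + 1 + 4 * (3 * e + 2) + 4 * (3 * e + 2) = 12 * (3 * e + 1) + 5 by ring,
      show 12 * e + 1 + 4 * (3 * e + 2) = 12 * (2 * e) + 9 by ring,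
      (partCount_one_two_three_four _).1, (partCount_one_two_three_four _).2.1,
      (partCount_one_two_three_four _).2.2]
    ring
  | succ t ih =>
    rw [show 12 * (3 * e + 2) * (t + 1) + 36 * e + 17 = 12 * (3 * e + 2) * t + 36 * e + 17 +
        4 * (3 * e + 2) + 4 * (3 * e + 2) + 4 * (3 * e + 2) by ring, step, step, step, ih,
      show 12 * (3 * e + 2) * t + 36 * e + 17 + 4 * (3 * e + 2) + 4 * (3 * e + 2) +
        4 * (3 * e + 2) = 12 * (e * (3 * t + 6) + 2 * t + 3) + 5 by ring,
      show 12 * (3 * e + 2) * t + 36 * e + 17 + 4 * (3 * e + 2) + 4 * (3 * e + 2) =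
        12 * (e * (3 * t + 5) + 2 * t + 2) + 9 by ring,
      show 12 * (3 * e + 2) * t + 36 * e + 17 + 4 * (3 * e + 2) =
        12 * (e * (3 * t + 4) + 2 * t + 2) + 1 by ring,
      (partCount_one_two_three_four _).1, (partCount_one_two_three_four _).2.1,
      (partCount_one_two_three_four _).2.2]
    ring

theorem stmt19 (a : ℕ) (ha : 3 ≤ a)
    (hmod : a % 12 = 1 ∨ a % 12 = 2 ∨ a % 12 = 5 ∨ a % 12 = 7 ∨ a % 12 = 10 ∨ a % 12 = 11) :
    {xy : ℕ × ℕ | 0 < xy.1 ∧ 0 < xy.2 ∧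
      partCount {1, 2, a} xy.1 = partCount {1, 2, 3, 4, 4 * a} xy.2}.Infinite := by
  suffices h : ∃ M r : ℕ, ∃ w : ℕ → ℕ, 0 < M ∧ 0 < r ∧ ∀ t,
      partCount {1, 2, a} (M + 2 * a * w t) = partCount {1, 2, 3, 4, 4 * a} (12 * a * t + r) by
    obtain ⟨M, r, w, hM, hr, h⟩ := h
    refine Set.infinite_of_injective_forall_mem
      (f := fun t : ℕ => (M + 2 * a * w t, 12 * a * t + r))
      (fun s t hst => ?_) fun t => ⟨by positivity, by positivity, h t⟩
    have h2 := add_right_cancel (congrArg Prod.snd hst)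
    exact Nat.eq_of_mul_eq_mul_left (by positivity) h2
  have h3 : a % 3 = 1 ∨ a % 3 = 2 := by omega
  rcases h3 with h3 | h3
  · obtain ⟨e, rfl⟩ : ∃ e, a = 3 * e + 1 := ⟨a / 3, by omega⟩
    refine ⟨2 * (3 * e + 1) - (e + 4) / 2, 36 * e + 9,
      fun t => 3 * (3 * e + 1) * (t + 1) ^ 2 + (3 * e + 2) * t + 3 * e + 1,
      by omega, by omega, fun t => ?_⟩
    rw [partCount_one_two_insert (c := 4 * e + 1) ha (by omega) (by omega), ← add_assoc,
      partCount_at_neg_three (by omega)]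
  · obtain ⟨e, rfl⟩ : ∃ e, a = 3 * e + 2 := ⟨a / 3, by omega⟩
    refine ⟨2 * (3 * e + 2) - (5 * e + 7) / 2, 36 * e + 17,
      fun t => 3 * (3 * e + 2) * (t + 1) ^ 2 + (3 * e + 1) * t + 3 * e,
      by omega, by omega, fun t => ?_⟩
    rw [partCount_one_two_insert (c := 2 * e + 1) ha (by omega) (by omega), ← add_assoc,
      partCount_at_neg_seven (by omega)]
end
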